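/- arXiv:1111.5447 — 5 statements merged into one kernel-verified Lean document; each statement's English description precedes it below -/
import Mathlib

section
/- Let X be an (abstract) rank one group with unipotent subgroups A and B. For each 1 ≠ a ∈ A, the element 1 ≠ b ∈ B with A^b = B^a is unique; that is, if b, b' ∈ B are both nontrivial and A^b = B^a = A^{b'}, then b = b'. Symmetrically, for each 1 ≠ b ∈ B the element 1 ≠ a ∈ A with B^a = A^b is unique. -/
/-- The conjugate subgroup `S^g = g⁻¹ S g`. -/
def conjSub {X : Type*} [Group X] (S : Subgroup X) (g : X) : Subgroup X :=
  S.map (MulAut.conj g⁻¹).toMonoidHom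

/-- `X` is an (abstract) rank one group with unipotent subgroups `A` and `B`:
`A ≠ B`, `X = ⟨A, B⟩`, for each `1 ≠ a ∈ A` there is `1 ≠ b ∈ B` with `A^b = B^a`,
and vice versa. -/
structure IsRankOneGroup {X : Type*} [Group X] (A B : Subgroup X) : Prop where
  ne : A ≠ B
  gen : A ⊔ B = ⊤
  exB : ∀ a ∈ A, a ≠ 1 → ∃ b ∈ B, b ≠ 1 ∧ conjSub A b = conjSub B a
  exA : ∀ b ∈ B, b ≠ 1 → ∃ a ∈ A, a ≠ 1 ∧ conjSub B a = conjSub A b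

/-- `bf` implements `a ↦ b(a)`, the unique `1 ≠ b ∈ B` with `A^b = B^a`, for `1 ≠ a ∈ A`. -/
def IsBFun {X : Type*} [Group X] (A B : Subgroup X) (bf : X → X) : Prop :=
  ∀ a ∈ A, a ≠ 1 → bf a ∈ B ∧ bf a ≠ 1 ∧ conjSub A (bf a) = conjSub B a

/-- `af` implements `b ↦ a(b)`, the unique `1 ≠ a ∈ A` with `B^a = A^b`, for `1 ≠ b ∈ B`. -/
def IsAFun {X : Type*} [Group X] (A B : Subgroup X) (af : X → X) : Prop :=
  ∀ b ∈ B, b ≠ 1 → af b ∈ A ∧ af b ≠ 1 ∧ conjSub B (af b) = conjSub A b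

/-- `X` is special: `b(a⁻¹) = b(a)⁻¹` for all `1 ≠ a ∈ A`. -/
def IsSpecialBFun {X : Type*} [Group X] (A B : Subgroup X) (bf : X → X) : Prop :=
  IsBFun A B bf ∧ ∀ a ∈ A, a ≠ 1 → bf a⁻¹ = (bf a)⁻¹

/-- The special rank one group condition, phrased without a chosen `b`-function. -/
def IsSpecial {X : Type*} [Group X] (A B : Subgroup X) : Prop :=
  ∃ bf : X → X, IsSpecialBFun A B bf

theorem conjSub_mul {X : Type*} [Group X] (S : Subgroup X) (g k : X) :
    conjSub S (g * k) = conjSub (conjSub S g) k := by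
  simp only [conjSub, Subgroup.map_map]
  congr 1
  ext x
  simp [mul_assoc]

theorem conjSub_one {X : Type*} [Group X] (S : Subgroup X) : conjSub S 1 = S := by
  ext x
  simp [conjSub]

theorem conjSub_injective {X : Type*} [Group X] (g : X) :
    Function.Injective fun S : Subgroup X => conjSub S g :=
  Subgroup.map_injective (MulAut.conj g⁻¹).injective

theorem conjSub_eq_self_of_mem {X : Type*} [Group X] {S : Subgroup X} {g : X} (hg : g ∈ S) :
    conjSub S g = S :=
  Subgroup.conj_smul_eq_self_of_mem (S.inv_mem hg)

/-- If every nontrivial `t ∈ T` admits `s ∈ S` with `T^s = S^t`, and `S ≠ T`, then distinct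
elements of `T` conjugate `S` to distinct subgroups. -/
theorem eq_of_conjSub_eq {X : Type*} [Group X] {S T : Subgroup X} (hne : S ≠ T)
    (hex : ∀ t ∈ T, t ≠ 1 → ∃ s ∈ S, s ≠ 1 ∧ conjSub T s = conjSub S t)
    {t t' : X} (ht : t ∈ T) (ht' : t' ∈ T) (heq : conjSub S t = conjSub S t') : t = t' := by
  by_contra hn
  obtain ⟨s, hs, -, hst⟩ := hex (t * t'⁻¹) (T.mul_mem ht (T.inv_mem ht'))
    (mt mul_inv_eq_one.mp hn)
  rw [conjSub_mul, heq, ← conjSub_mul, mul_inv_cancel, conjSub_one] at hst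
  exact hne (conjSub_injective s ((conjSub_eq_self_of_mem hs).trans hst.symm))

/-- In a rank one group, the element `b(a)` is unique, and symmetrically `a(b)` is unique. -/
theorem rankOne_b_and_a_unique {X : Type*} [Group X] (A B : Subgroup X)
    (h : IsRankOneGroup A B) :
    (∀ a ∈ A, a ≠ 1 → ∀ b ∈ B, b ≠ 1 → ∀ b' ∈ B, b' ≠ 1 →
      conjSub A b = conjSub B a → conjSub A b' = conjSub B a → b = b') ∧
    (∀ b ∈ B, b ≠ 1 → ∀ a ∈ A, a ≠ 1 → ∀ a' ∈ A, a' ≠ 1 →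
      conjSub B a = conjSub A b → conjSub B a' = conjSub A b → a = a') := by
  exact ⟨fun a _ _ b hb _ b' hb' _ h₁ h₂ => eq_of_conjSub_eq h.ne h.exA hb hb' (h₁.trans h₂.symm),
    fun b _ _ a ha _ a' ha' _ h₁ h₂ =>
      eq_of_conjSub_eq h.ne.symm h.exB ha ha' (h₁.trans h₂.symm)⟩
end

section
/- Let X be an (abstract) rank one group with unipotent subgroups A and B. Then N_A(B) = 1; that is, if a ∈ A satisfies B^a = B, then a = 1. -/
theorem mem_conjSub_iff {X : Type*} [Group X] {S : Subgroup X} {g x : X} :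
    x ∈ conjSub S g ↔ g * x * g⁻¹ ∈ S := by
  constructor
  · rintro ⟨y, hy, rfl⟩
    simpa [mul_assoc] using hy
  · intro hx
    exact ⟨g * x * g⁻¹, hx, by simp [mul_assoc]⟩

theorem eq_of_conjSub_eq_s1 {X : Type*} [Group X] {A B : Subgroup X} {b : X}
    (hb : b ∈ B) (h : conjSub A b = B) : A = B := by
  ext x
  have hx : b⁻¹ * x * b ∈ conjSub A b ↔ x ∈ A := by
    simp [mem_conjSub_iff, mul_assoc]
  rw [← hx, h, B.mul_mem_cancel_right hb, B.mul_mem_cancel_left (B.inv_mem hb)]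

/-- In a rank one group, `N_A(B) = 1`. -/
theorem rankOne_normalizer_trivial {X : Type*} [Group X] (A B : Subgroup X)
    (h : IsRankOneGroup A B) :
    ∀ a ∈ A, conjSub B a = B → a = 1 := by
  intro a ha hB
  by_contra ha1
  obtain ⟨b, hb, -, hab⟩ := h.exB a ha ha1
  exact h.ne (eq_of_conjSub_eq_s1 hb (hab.trans hB))
end

section
/- Let X be an (abstract) rank one group with unipotent subgroups A and B. For each 1 ≠ a ∈ A, setting n(a) = a·b(a)⁻¹·a, one has B^{n(a)} = A. -/
/-- For `1 ≠ a ∈ A` and `n(a) = a·b(a)⁻¹·a`, one has `B^{n(a)} = A`. -/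
theorem rankOne_conj_B_n_eq_A {X : Type*} [Group X] (A B : Subgroup X)
    (h : IsRankOneGroup A B) (bf : X → X) (hbf : IsBFun A B bf) :
    ∀ a ∈ A, a ≠ 1 → conjSub B (a * (bf a)⁻¹ * a) = A := by
  intro a ha ha1
  rw [conjSub_mul, conjSub_mul, ← (hbf a ha ha1).2.2, ← conjSub_mul A, mul_inv_cancel,
    conjSub_one, conjSub_eq_self_of_mem ha]
end

section
/- Let X be a special (abstract) rank one group with unipotent subgroups A and B. Then B^{a₁·a₂·n(a₂⁻¹)·a₂} = A^{b(a₁)·b(a₂)} for all 1 ≠ a₁ ∈ A and 1 ≠ a₂ ∈ A. -/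
/-- In a special rank one group, `B^{a₁·a₂·n(a₂⁻¹)·a₂} = A^{b(a₁)·b(a₂)}`
for all `1 ≠ a₁, a₂ ∈ A`. -/
theorem specialRankOne_useful_equation {X : Type*} [Group X] (A B : Subgroup X)
    (h : IsRankOneGroup A B) (bf : X → X) (hbf : IsSpecialBFun A B bf) :
    ∀ a₁ ∈ A, a₁ ≠ 1 → ∀ a₂ ∈ A, a₂ ≠ 1 →
      conjSub B (a₁ * a₂ * (a₂⁻¹ * (bf a₂⁻¹)⁻¹ * a₂⁻¹) * a₂) =
        conjSub A (bf a₁ * bf a₂) := by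
  intro a₁ ha₁ hne₁ a₂ ha₂ hne₂
  have key : a₁ * a₂ * (a₂⁻¹ * (bf a₂⁻¹)⁻¹ * a₂⁻¹) * a₂ = a₁ * bf a₂ := by
    rw [hbf.2 a₂ ha₂ hne₂]
    group
  rw [key, conjSub_mul, conjSub_mul, (hbf.1 a₁ ha₁ hne₁).2.2]
end

section
/- Let X be a special (abstract) rank one group with unipotent subgroups A and B. If A ∩ [X,X] = 1, then there exists 1 ≠ a ∈ A with A ⊆ {1, a, a⁻¹}; in particular |A| ≤ 3. -/
/-- Membership in a conjugate `S^g`. -/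
theorem mem_conjSub {X : Type*} [Group X] (S : Subgroup X) (g x : X) :
    x ∈ conjSub S g ↔ g * x * g⁻¹ ∈ S := by
  constructor
  · rintro ⟨s, hs, rfl⟩
    simpa [mul_assoc] using hs
  · intro hx
    exact ⟨_, hx, by simp [mul_assoc]⟩

/-- Conjugation of subgroups is a right action. -/
theorem conjSub_conjSub {X : Type*} [Group X] (S : Subgroup X) (g k : X) :
    conjSub (conjSub S g) k = conjSub S (g * k) := by
  ext x
  simp [mem_conjSub, mul_assoc]

theorem conjSub_of_mem {X : Type*} [Group X] (S : Subgroup X) {g : X} (hg : g ∈ S) :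
    conjSub S g = S := by
  ext x
  rw [mem_conjSub, S.mul_mem_cancel_right (S.inv_mem hg), S.mul_mem_cancel_left hg]

theorem conjSub_eq_iff {X : Type*} [Group X] (S T : Subgroup X) (g : X) :
    conjSub S g = T ↔ S = conjSub T g⁻¹ := by
  constructor
  · rintro rfl
    rw [conjSub_conjSub, mul_inv_cancel, conjSub_one]
  · rintro rfl
    rw [conjSub_conjSub, inv_mul_cancel, conjSub_one]

namespace IsRankOneGroup

variable {X : Type*} [Group X] {A B : Subgroup X}

/-- `N_A(B) = 1`. -/
theorem eq_one_of_conjSub_right (h : IsRankOneGroup A B) {a : X} (ha : a ∈ A)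
    (hB : conjSub B a = B) : a = 1 := by
  by_contra hne
  obtain ⟨b, hb, -, hab⟩ := h.exB a ha hne
  rw [hB, conjSub_eq_iff, conjSub_of_mem B (B.inv_mem hb)] at hab
  exact h.ne hab

/-- `N_B(A) = 1`. -/
theorem eq_one_of_conjSub_left (h : IsRankOneGroup A B) {b : X} (hb : b ∈ B)
    (hA : conjSub A b = A) : b = 1 := by
  by_contra hne
  obtain ⟨a, ha, -, hab⟩ := h.exA b hb hne
  rw [hA, conjSub_eq_iff, conjSub_of_mem A (A.inv_mem ha)] at hab
  exact h.ne hab.symm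

theorem exists_ne_one (h : IsRankOneGroup A B) : ∃ a ∈ A, a ≠ 1 := by
  by_contra! hA
  refine h.ne (le_antisymm (fun a ha => hA a ha ▸ B.one_mem) fun b hb => ?_)
  by_contra hbA
  obtain ⟨a, ha, hne, -⟩ := h.exA b hb fun hb1 => hbA (hb1 ▸ A.one_mem)
  exact hne (hA a ha)

end IsRankOneGroup

section CommutatorTrivialIntersection

variable {X : Type*} [Group X] {A B : Subgroup X}

/-- If `A ∩ [X,X] = 1`, elements of `A` that are conjugate in `X` are equal. -/
theorem eq_of_conj_mem (htriv : A ⊓ commutator X = ⊥) {a g : X} (ha : a ∈ A)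
    (hg : g * a * g⁻¹ ∈ A) : g * a * g⁻¹ = a := by
  have hmem : g * a * g⁻¹ * a⁻¹ ∈ A ⊓ commutator X :=
    ⟨A.mul_mem hg (A.inv_mem ha),
      Subgroup.commutator_mem_commutator (Subgroup.mem_top g) (Subgroup.mem_top a)⟩
  rw [htriv, Subgroup.mem_bot] at hmem
  exact mul_inv_eq_one.mp hmem

theorem mul_comm_of_mem (htriv : A ⊓ commutator X = ⊥) {a c : X} (ha : a ∈ A) (hc : c ∈ A) :
    a * c = c * a :=
  mul_inv_eq_iff_eq_mul.mp
    (eq_of_conj_mem htriv hc (A.mul_mem (A.mul_mem ha hc) (A.inv_mem ha)))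

/-- If `A ∩ [X,X] = 1`, two elements conjugating `A` to `B` induce the same map `A → B`. -/
theorem conj_eq_conj_of_conjSub_eq (htriv : A ⊓ commutator X = ⊥) {x y c : X}
    (hx : conjSub A x = B) (hy : conjSub A y = B) (hc : c ∈ A) :
    x⁻¹ * c * x = y⁻¹ * c * y := by
  have hB : x⁻¹ * c * x ∈ conjSub A y := by
    rw [hy, ← hx, mem_conjSub]
    simpa [mul_assoc] using hc
  rw [mem_conjSub] at hB
  have key := eq_of_conj_mem htriv (g := y * x⁻¹) hc (by simpa [mul_assoc] using hB)
  calc x⁻¹ * c * x = y⁻¹ * (y * x⁻¹ * c * (y * x⁻¹)⁻¹) * y := by group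
    _ = y⁻¹ * c * y := by rw [key]

end CommutatorTrivialIntersection

namespace IsSpecialBFun

variable {X : Type*} [Group X] {A B : Subgroup X} {bf : X → X}

theorem conjSub_left_inv (hb : IsSpecialBFun A B bf) {a : X} (ha : a ∈ A) (hne : a ≠ 1) :
    conjSub A (bf a)⁻¹ = conjSub B a⁻¹ := by
  rw [← hb.2 a ha hne]
  exact (hb.1 a⁻¹ (A.inv_mem ha) (inv_ne_one.mpr hne)).2.2

/-- `a b(a)⁻¹ a` conjugates `A` to `B`. -/
theorem conjSub_left (hb : IsSpecialBFun A B bf) {a : X} (ha : a ∈ A) (hne : a ≠ 1) :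
    conjSub A (a * (bf a)⁻¹ * a) = B := by
  rw [← conjSub_conjSub, ← conjSub_conjSub, conjSub_of_mem A ha, hb.conjSub_left_inv ha hne,
    conjSub_conjSub, inv_mul_cancel, conjSub_one]

/-- `a b(a)⁻¹ a` conjugates `B` to `A`. -/
theorem conjSub_right (hb : IsSpecialBFun A B bf) {a : X} (ha : a ∈ A) (hne : a ≠ 1) :
    conjSub B (a * (bf a)⁻¹ * a) = A := by
  rw [← conjSub_conjSub, ← conjSub_conjSub, ← (hb.1 a ha hne).2.2, conjSub_conjSub A,
    mul_inv_cancel, conjSub_one, conjSub_of_mem A ha]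

/-- Conjugation by `a b(a)⁻¹ a` maps `a` to `b(a)⁻¹`. -/
theorem conj_self (h : IsRankOneGroup A B) (hb : IsSpecialBFun A B bf) {a : X} (ha : a ∈ A)
    (hne : a ≠ 1) :
    (a * (bf a)⁻¹ * a)⁻¹ * a * (a * (bf a)⁻¹ * a) = (bf a)⁻¹ := by
  set n := a * (bf a)⁻¹ * a with hn
  have hbB := (hb.1 a ha hne).1
  have hmem : n⁻¹ * a * n ∈ B := by
    rw [← hb.conjSub_left ha hne, mem_conjSub]
    simpa [← hn, mul_assoc] using ha
  have hfix : conjSub A (bf a * (n⁻¹ * a * n)) = A := by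
    rw [← conjSub_conjSub, (hb.1 a ha hne).2.2, conjSub_conjSub]
    have : a * (n⁻¹ * a * n) = bf a * n := by
      rw [hn]; group
    rw [this, ← conjSub_conjSub, conjSub_of_mem B hbB, hb.conjSub_right ha hne]
  exact eq_inv_of_mul_eq_one_right (h.eq_one_of_conjSub_left (B.mul_mem hbB hmem) hfix)

/-- If `A ∩ [X,X] = 1`, every `n` conjugating `A` to `B` maps each `1 ≠ c ∈ A` to `b(c)⁻¹`. -/
theorem conj_eq_inv (h : IsRankOneGroup A B) (hb : IsSpecialBFun A B bf)
    (htriv : A ⊓ commutator X = ⊥) {n c : X} (hn : conjSub A n = B) (hc : c ∈ A)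
    (hne : c ≠ 1) : n⁻¹ * c * n = (bf c)⁻¹ := by
  rw [← conj_self h hb hc hne]
  exact conj_eq_conj_of_conjSub_eq htriv hn (hb.conjSub_left hc hne) hc

/-- If `A ∩ [X,X] = 1`, any two distinct nontrivial elements of `A` are mutually inverse. -/
theorem eq_inv_of_ne (h : IsRankOneGroup A B) (hb : IsSpecialBFun A B bf)
    (htriv : A ⊓ commutator X = ⊥) {a d : X} (ha : a ∈ A) (hd : d ∈ A)
    (ha1 : a ≠ 1) (hd1 : d ≠ 1) (hne : a ≠ d) : a = d⁻¹ := by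
  obtain ⟨c, rfl⟩ : ∃ c, d = a * c := ⟨a⁻¹ * d, by simp⟩
  have hc : c ∈ A := (A.mul_mem_cancel_left ha).mp hd
  have hc1 : c ≠ 1 := fun hc1 => hne (by simp [hc1])
  set n := c * (bf c)⁻¹ * c with hn
  have hnAB : conjSub A n = B := hb.conjSub_left hc hc1
  have hnBA : conjSub B n = A := hb.conjSub_right hc hc1
  have hbf : bf (a * c) = bf a * bf c := by
    rw [← inv_inj, mul_inv_rev, ← conj_eq_inv h hb htriv hnAB hd hd1,
      ← conj_eq_inv h hb htriv hnAB ha ha1, ← conj_eq_inv h hb htriv hnAB hc hc1,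
      mul_comm_of_mem htriv ha hc]
    group
  have hnd : n * (a * c) * n⁻¹ = (bf (a * c))⁻¹ := by
    have := conj_eq_inv h hb htriv (n := n⁻¹) (((conjSub_eq_iff _ _ _).mp hnBA).symm) hd hd1
    simpa using this
  have hBa : conjSub B (a * bf c) = conjSub B (a * c) := by
    rw [← (hb.1 _ hd hd1).2.2, hbf, ← conjSub_conjSub, ← conjSub_conjSub A,
      (hb.1 a ha ha1).2.2]
  have hfact : a * bf c = n⁻¹ * (n * (a * c) * n⁻¹) * c := by
    rw [hn]; group
  have hBn : conjSub B n⁻¹ = A := ((conjSub_eq_iff A B n).mp hnAB).symm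
  rw [hfact, hnd, ← conjSub_conjSub, ← conjSub_conjSub, ← conjSub_conjSub B a c, hBn,
    hb.conjSub_left_inv hd hd1, conjSub_eq_iff, conjSub_conjSub _ c, mul_inv_cancel,
    conjSub_one] at hBa
  refine eq_inv_of_mul_eq_one_left (h.eq_one_of_conjSub_right (A.mul_mem ha hd) ?_)
  rw [← conjSub_conjSub, ← hBa, conjSub_conjSub, inv_mul_cancel, conjSub_one]

end IsSpecialBFun

/-- In a special rank one group with `A ∩ [X,X] = 1`, there is `1 ≠ a ∈ A` with
`A ⊆ {1, a, a⁻¹}`; in particular `|A| ≤ 3`. -/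
theorem specialRankOne_small_A {X : Type*} [Group X] (A B : Subgroup X)
    (h : IsRankOneGroup A B) (hsp : IsSpecial A B)
    (htriv : A ⊓ commutator X = ⊥) :
    ∃ a ∈ A, a ≠ 1 ∧ (A : Set X) ⊆ {1, a, a⁻¹} ∧ Nat.card A ≤ 3 := by
  obtain ⟨bf, hb⟩ := hsp
  obtain ⟨a, ha, ha1⟩ := h.exists_ne_one
  have hsub : (A : Set X) ⊆ {1, a, a⁻¹} := by
    intro x hx
    by_contra hxa
    simp only [Set.mem_insert_iff, Set.mem_singleton_iff, not_or] at hxa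
    exact hxa.2.2 (hb.eq_inv_of_ne h htriv hx ha hxa.1 ha1 hxa.2.1)
  refine ⟨a, ha, ha1, hsub, ?_⟩
  calc Nat.card A = (A : Set X).ncard := rfl
    _ ≤ ({1, a, a⁻¹} : Set X).ncard := Set.ncard_le_ncard hsub (by simp)
    _ ≤ ({a, a⁻¹} : Set X).ncard + 1 := Set.ncard_insert_le _ _
    _ ≤ 3 := Nat.succ_le_succ (Set.ncard_insert_le _ _ |>.trans (by simp))
end
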